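/- arXiv:1901.05374 — 2 statements merged into one kernel-verified Lean document; each statement's English description precedes it below -/
import Mathlib

section
/- Let n ≥ 1 and 0 < δ ≤ 0.7, and let V ⊆ {−1,1}ⁿ be such that the Hamming distance satisfies Δ(v,v′) ≥ n/4 for all distinct v, v′ ∈ V. Then for all distinct v, v′ ∈ V, d(v,v′) ≥ (n/2)(1 − cos δ) ≥ n δ² / 5, where d(v,v′) := min over unit vectors φ ∈ ℂ^{2ⁿ} of (⟨φ, H_v^δ φ⟩ + n) + (⟨φ, H_{v′}^δ φ⟩ + n). -/
open Matrix Real Finset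

/-- Single-site Pauli X on qubit `i` of an `n`-qubit system. -/
noncomputable def pauliX (n : ℕ) (i : Fin n) : Matrix (Fin n → Fin 2) (Fin n → Fin 2) ℂ :=
  fun f g => if f i ≠ g i ∧ ∀ j, j ≠ i → f j = g j then 1 else 0

/-- Single-site Pauli Z on qubit `i` of an `n`-qubit system. -/
noncomputable def pauliZ (n : ℕ) (i : Fin n) : Matrix (Fin n → Fin 2) (Fin n → Fin 2) ℂ :=
  fun f g => if f = g then (-1 : ℂ) ^ ((f i : ℕ)) else 0

/-- The objective observable `H_v^δ = -∑ᵢ [sin(π/4 + vᵢ δ) Xᵢ + cos(π/4 + vᵢ δ) Zᵢ]`. -/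
noncomputable def Ham (n : ℕ) (δ : ℝ) (v : Fin n → ℝ) :
    Matrix (Fin n → Fin 2) (Fin n → Fin 2) ℂ :=
  - ∑ i : Fin n, (((Real.sin (π/4 + v i * δ) : ℝ) : ℂ) • pauliX n i
      + ((Real.cos (π/4 + v i * δ) : ℝ) : ℂ) • pauliZ n i)

/-- The quadratic form `⟨ψ, M ψ⟩`, conjugate-linear in the first argument. -/
noncomputable def qform {m : Type*} [Fintype m] (M : Matrix m m ℂ) (ψ : m → ℂ) : ℂ :=
  star ψ ⬝ᵥ M.mulVec ψ

/-- Flip the bit at site `i`. -/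
def flipBit {n : ℕ} (i : Fin n) (f : Fin n → Fin 2) : Fin n → Fin 2 :=
  Function.update f i (f i + 1)

lemma flipBit_involutive {n : ℕ} (i : Fin n) : Function.Involutive (flipBit i) := by
  intro f
  have h : ∀ a : Fin 2, a + 1 + 1 = a := by decide
  simp [flipBit, h]

lemma pauliX_apply {n : ℕ} (i : Fin n) (f g : Fin n → Fin 2) :
    pauliX n i f g = if g = flipBit i f then 1 else 0 := by
  unfold pauliX
  refine if_congr ?_ rfl rfl
  have h : ∀ a b : Fin 2, a ≠ b ↔ b = a + 1 := by decide
  rw [h, flipBit, Function.eq_update_iff]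
  exact and_congr_right fun _ => forall₂_congr fun _ _ => eq_comm

lemma pauliX_mulVec {n : ℕ} (i : Fin n) (φ : (Fin n → Fin 2) → ℂ) (f : Fin n → Fin 2) :
    (pauliX n i).mulVec φ f = φ (flipBit i f) := by
  simp [Matrix.mulVec, dotProduct, pauliX_apply]

lemma pauliZ_mulVec {n : ℕ} (i : Fin n) (φ : (Fin n → Fin 2) → ℂ) (f : Fin n → Fin 2) :
    (pauliZ n i).mulVec φ f = (-1) ^ (f i : ℕ) * φ f := by
  simp [Matrix.mulVec, dotProduct, pauliZ]

lemma qform_Ham_re (n : ℕ) (δ : ℝ) (v : Fin n → ℝ) (φ : (Fin n → Fin 2) → ℂ) :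
    (qform (Ham n δ v) φ).re =
      -∑ i, (Real.sin (π / 4 + v i * δ) * (qform (pauliX n i) φ).re
        + Real.cos (π / 4 + v i * δ) * (qform (pauliZ n i) φ).re) := by
  simp only [qform, Ham, Matrix.neg_mulVec, Matrix.sum_mulVec, Matrix.add_mulVec,
    Matrix.smul_mulVec, dotProduct_neg, dotProduct_sum, dotProduct_add, dotProduct_smul,
    Complex.neg_re, Complex.re_sum, Complex.add_re, smul_eq_mul, Complex.re_ofReal_mul]

lemma sin_cos_form_le (θ a p : ℝ) :
    2 * Real.sin θ * (a * p) + Real.cos θ * (a ^ 2 - p ^ 2) ≤ a ^ 2 + p ^ 2 := by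
  have hs : Real.sin θ = 2 * Real.sin (θ / 2) * Real.cos (θ / 2) := by
    rw [← Real.sin_two_mul]; ring_nf
  have hc : Real.cos θ = Real.cos (θ / 2) ^ 2 - Real.sin (θ / 2) ^ 2 := by
    rw [← Real.cos_two_mul']; ring_nf
  have h1 := Real.sin_sq_add_cos_sq (θ / 2)
  rw [hs, hc]
  have key : a ^ 2 + p ^ 2 = (Real.sin (θ / 2) ^ 2 + Real.cos (θ / 2) ^ 2) * (a ^ 2 + p ^ 2) := by
    rw [h1, one_mul]
  rw [key]
  nlinarith [sq_nonneg (Real.sin (θ / 2) * a - Real.cos (θ / 2) * p)]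

/-- A single-site Pauli observable in the `X`-`Z` plane has expectation at most one. -/
lemma pauli_expectation_le_one {n : ℕ} (i : Fin n) (θ : ℝ) {φ : (Fin n → Fin 2) → ℂ}
    (hφ : star φ ⬝ᵥ φ = 1) :
    Real.sin θ * (qform (pauliX n i) φ).re + Real.cos θ * (qform (pauliZ n i) φ).re ≤ 1 := by
  have hnorm : ∑ f, ((φ f).re ^ 2 + (φ f).im ^ 2) = 1 := by
    have := congrArg Complex.re hφ
    simpa [dotProduct, Complex.re_sum, Complex.mul_re, sq] using this
  set F : (Fin n → Fin 2) → ℝ := fun f =>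
    (φ f).re ^ 2 + (φ f).im ^ 2
      - (Real.sin θ * (star (φ f) * φ (flipBit i f)).re
        + Real.cos θ * (star (φ f) * ((-1) ^ (f i : ℕ) * φ f)).re) with hF
  have hsum : ∑ f, F f =
      1 - (Real.sin θ * (qform (pauliX n i) φ).re + Real.cos θ * (qform (pauliZ n i) φ).re) := by
    simp only [hF, sum_sub_distrib, sum_add_distrib, ← mul_sum, qform, dotProduct,
      pauliX_mulVec, pauliZ_mulVec, Pi.star_apply, Complex.re_sum]
    rw [← sum_add_distrib, hnorm]
  have hswap : ∑ f, F (flipBit i f) = ∑ f, F f :=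
    Equiv.sum_comp (flipBit_involutive i).toPerm F
  have hpos : 0 ≤ ∑ f, (F f + F (flipBit i f)) := by
    refine sum_nonneg fun f _ => ?_
    have hflip : flipBit i f i = f i + 1 := by simp [flipBit]
    simp only [hF, flipBit_involutive i f, hflip]
    have h2 : ∀ a : Fin 2, a = 0 ∨ a = 1 := by decide
    set g := flipBit i f
    rcases h2 (f i) with h | h <;> rw [h]
    · have := sin_cos_form_le θ (φ f).re (φ g).re
      have := sin_cos_form_le θ (φ f).im (φ g).im
      simp [Complex.mul_re]
      nlinarith
    · have := sin_cos_form_le θ (φ g).re (φ f).re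
      have := sin_cos_form_le θ (φ g).im (φ f).im
      simp [Complex.mul_re]
      nlinarith
  rw [sum_add_distrib, hswap, hsum] at hpos
  linarith

lemma two_fifths_sq_le_one_sub_cos {δ : ℝ} (hδ : |δ| ≤ 1) :
    2 / 5 * δ ^ 2 ≤ 1 - Real.cos δ := by
  have h := (abs_le.mp (Real.cos_bound hδ)).2
  rw [pow_abs, abs_of_nonneg (by positivity : (0 : ℝ) ≤ δ ^ 4)] at h
  nlinarith [sq_nonneg δ, (sq_le_one_iff_abs_le_one δ).2 hδ]

/-- The contribution of one site to the sum of the two excess energies. -/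
lemma site_excess_ge {δ x z a b : ℝ} (h : ∀ θ, Real.sin θ * x + Real.cos θ * z ≤ 1)
    (hδ : 0 ≤ Real.cos δ) (ha : a = 1 ∨ a = -1) (hb : b = 1 ∨ b = -1) :
    (if a ≠ b then 2 * (1 - Real.cos δ) else 0) ≤
      (1 - (Real.sin (π / 4 + a * δ) * x + Real.cos (π / 4 + a * δ) * z))
        + (1 - (Real.sin (π / 4 + b * δ) * x + Real.cos (π / 4 + b * δ) * z)) := by
  split_ifs with hab
  · have hb' : b = -a := by
      rcases ha with rfl | rfl <;> rcases hb with rfl | rfl <;> simp_all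
    have hcos : Real.cos (a * δ) = Real.cos δ := by
      rcases ha with rfl | rfl <;> simp
    subst hb'
    rw [neg_mul, ← sub_eq_add_neg, Real.sin_add, Real.cos_add, Real.sin_sub, Real.cos_sub, hcos]
    nlinarith [mul_le_mul_of_nonneg_left (h (π / 4)) hδ]
  · linarith [h (π / 4 + a * δ), h (π / 4 + b * δ)]

/-- If `V ⊆ {-1,1}ⁿ` has pairwise Hamming distance `≥ n/4` and `0 < δ ≤ 0.7`, then for all
distinct `v, v' ∈ V` the semimetric `d(v,v')` (the minimum over unit vectors `φ` of
`(⟨φ,H_v^δφ⟩+n) + (⟨φ,H_{v'}^δφ⟩+n)`) satisfies `d(v,v') ≥ (n/2)(1 - cos δ) ≥ n δ² / 5`. -/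
theorem packing_lower_bound (n : ℕ) (hn : 1 ≤ n) (δ : ℝ) (hδ0 : 0 < δ) (hδ : δ ≤ 0.7)
    (V : Finset (Fin n → ℝ)) (hV : ∀ v ∈ V, ∀ i, v i = 1 ∨ v i = -1)
    (hsep : ∀ v ∈ V, ∀ v' ∈ V, v ≠ v' → ((n : ℝ) / 4) ≤ hammingDist v v') :
    ∀ v ∈ V, ∀ v' ∈ V, v ≠ v' →
      (∀ φ : (Fin n → Fin 2) → ℂ, star φ ⬝ᵥ φ = 1 →
        ((n : ℝ) / 2) * (1 - Real.cos δ) ≤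
          ((qform (Ham n δ v) φ).re + n) + ((qform (Ham n δ v') φ).re + n)) ∧
      (n : ℝ) * δ ^ 2 / 5 ≤ ((n : ℝ) / 2) * (1 - Real.cos δ) := by
  intro v hv v' hv' hne
  have habs : |δ| ≤ 1 := by rw [abs_of_pos hδ0]; norm_num at hδ; linarith
  have hcos : 0 ≤ Real.cos δ := (Real.cos_pos_of_le_one habs).le
  have hn0 : (0 : ℝ) ≤ n := n.cast_nonneg
  refine ⟨fun φ hφ => ?_, ?_⟩
  · have hsite := sum_le_sum fun i (_ : i ∈ univ) =>
      site_excess_ge (fun θ => pauli_expectation_le_one i θ hφ) hcos (hV v hv i) (hV v' hv' i)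
    rw [← sum_filter, sum_const, nsmul_eq_mul, sum_add_distrib, sum_sub_distrib,
      sum_sub_distrib] at hsite
    simp only [sum_const, card_univ, Fintype.card_fin, nsmul_eq_mul, mul_one] at hsite
    have hdist := hsep v hv v' hv' hne
    rw [hammingDist] at hdist
    rw [qform_Ham_re, qform_Ham_re]
    nlinarith [mul_le_mul_of_nonneg_right hdist (sub_nonneg.2 (Real.cos_le_one δ))]
  · nlinarith [mul_le_mul_of_nonneg_left (two_fifths_sq_le_one_sub_cos habs) hn0]
end

section
/- Let r ∈ ℝ³ with ‖r‖ ≤ 1, let 0 < δ ≤ 0.7, let u ∈ {−1,1}, and set α := ∠(r, n̂^{uδ}). For s ∈ {−1,1} define p_s := 1/2 − (1/(2√2))·⟨r, n̂⁰ + s·tan(δ)·ŵ⟩, where n̂⁰ = (1/√2, 0, 1/√2) and ŵ = (1/√2, 0, −1/√2). Then 0.01 ≤ p_s ≤ 0.99 for both s, and both KL divergences in bits between the corresponding Bernoulli distributions are bounded: p_{+1}·log₂(p_{+1}/p_{−1}) + (1−p_{+1})·log₂((1−p_{+1})/(1−p_{−1})) ≤ 150·δ²·(α+δ)², and likewise with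 p_{+1} and p_{−1} interchanged. -/
open Real InnerProductGeometry
open scoped RealInnerProductSpace

/-- The unit vector `n̂^θ = (sin(π/4+θ), 0, cos(π/4+θ)) ∈ ℝ³`. -/
noncomputable def nhat (θ : ℝ) : EuclideanSpace ℝ (Fin 3) :=
  (WithLp.equiv 2 (Fin 3 → ℝ)).symm ![Real.sin (π/4 + θ), 0, Real.cos (π/4 + θ)]

/-- The vector `ŵ = (1/√2, 0, -1/√2) ∈ ℝ³`. -/
noncomputable def what : EuclideanSpace ℝ (Fin 3) :=
  (WithLp.equiv 2 (Fin 3 → ℝ)).symm ![1 / Real.sqrt 2, 0, -(1 / Real.sqrt 2)]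

/-- The heads-probability of the internal coin of the zeroth-order sampling oracle at a qubit
with Bloch vector `r`: `p_s := 1/2 - (1/(2√2)) ⟨r, n̂⁰ + s tan(δ) ŵ⟩`. -/
noncomputable def pcoin (r : EuclideanSpace ℝ (Fin 3)) (δ s : ℝ) : ℝ :=
  1 / 2 - (1 / (2 * Real.sqrt 2)) * ⟪r, nhat 0 + (s * Real.tan δ) • what⟫

/-- KL divergence in bits between Bernoulli distributions with parameters `q` and `r`. -/
noncomputable def klBits (q r : ℝ) : ℝ :=
  q * Real.logb 2 (q / r) + (1 - q) * Real.logb 2 ((1 - q) / (1 - r))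

lemma klBits_le_chi_sq {p q : ℝ} (hp0 : 0 < p) (hp1 : p < 1) (hq0 : 0 < q) (hq1 : q < 1) :
    klBits p q ≤ (p - q) ^ 2 / (q * (1 - q) * Real.log 2) := by
  have hl : 0 < Real.log 2 := Real.log_pos one_lt_two
  have hp1' : 0 < 1 - p := by linarith
  have hq1' : 0 < 1 - q := by linarith
  have h1 := mul_le_mul_of_nonneg_left (Real.log_le_sub_one_of_pos (div_pos hp0 hq0)) hp0.le
  have h2 := mul_le_mul_of_nonneg_left (Real.log_le_sub_one_of_pos (div_pos hp1' hq1')) hp1'.le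
  have h3 : p * (p / q - 1) + (1 - p) * ((1 - p) / (1 - q) - 1) =
      (p - q) ^ 2 / (q * (1 - q)) := by
    field_simp
    ring
  have h4 : klBits p q = (p * Real.log (p / q) + (1 - p) * Real.log ((1 - p) / (1 - q))) /
      Real.log 2 := by
    unfold klBits Real.logb
    ring
  rw [h4, ← div_div]
  gcongr
  linarith

lemma tan_le_mul_of_le {δ : ℝ} (hδ0 : 0 < δ) (hδ : δ ≤ 0.7) : Real.tan δ ≤ 1.37 * δ := by
  have hc := Real.one_sub_sq_div_two_le_cos (x := δ)
  have hc' : (0.755 : ℝ) ≤ Real.cos δ := by nlinarith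
  rw [Real.tan_eq_sin_div_cos, div_le_iff₀ (by linarith)]
  have := Real.sin_le hδ0.le
  nlinarith

lemma inner_nhat (r : EuclideanSpace ℝ (Fin 3)) (θ : ℝ) :
    ⟪r, nhat θ⟫ = r 0 * Real.sin (π / 4 + θ) + r 2 * Real.cos (π / 4 + θ) := by
  simp [nhat, PiLp.inner_apply, Fin.sum_univ_three]
  ring

lemma inner_what (r : EuclideanSpace ℝ (Fin 3)) :
    ⟪r, what⟫ = (r 0 - r 2) / Real.sqrt 2 := by
  simp [what, PiLp.inner_apply, Fin.sum_univ_three]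
  ring

lemma inner_nhat_nhat (θ φ : ℝ) : ⟪nhat θ, nhat φ⟫ = Real.cos (θ - φ) := by
  rw [inner_nhat, show θ - φ = (π / 4 + θ) - (π / 4 + φ) by ring, Real.cos_sub]
  simp [nhat]
  ring

lemma norm_nhat (θ : ℝ) : ‖nhat θ‖ = 1 := by
  have h := real_inner_self_eq_norm_sq (nhat θ)
  rw [inner_nhat_nhat, sub_self, Real.cos_zero] at h
  nlinarith [norm_nonneg (nhat θ)]

lemma inner_nhat_zero_sq_add_inner_what_sq_le (r : EuclideanSpace ℝ (Fin 3)) :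
    ⟪r, nhat 0⟫ ^ 2 + ⟪r, what⟫ ^ 2 ≤ ‖r‖ ^ 2 := by
  have h2 : Real.sqrt 2 ^ 2 = 2 := Real.sq_sqrt (by norm_num)
  rw [inner_nhat, inner_what, EuclideanSpace.real_norm_sq_eq, Fin.sum_univ_three, add_zero,
    Real.sin_pi_div_four, Real.cos_pi_div_four, div_pow, h2]
  nlinarith [sq_nonneg (r 1)]

lemma angle_nhat_nhat_zero {δ u : ℝ} (hδ0 : 0 ≤ δ) (hδ : δ ≤ π) (hu : u = 1 ∨ u = -1) :
    angle (nhat (u * δ)) (nhat 0) = δ := by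
  rw [angle, inner_nhat_nhat, norm_nhat, norm_nhat, sub_zero, mul_one, div_one]
  rcases hu with rfl | rfl
  · rw [one_mul, Real.arccos_cos hδ0 hδ]
  · rw [neg_one_mul, Real.cos_neg, Real.arccos_cos hδ0 hδ]

lemma inner_what_sq_le {r : EuclideanSpace ℝ (Fin 3)} (hr : ‖r‖ ≤ 1) :
    ⟪r, what⟫ ^ 2 ≤ angle r (nhat 0) ^ 2 := by
  have h := inner_nhat_zero_sq_add_inner_what_sq_le r
  have hc := cos_angle_mul_norm_mul_norm r (nhat 0)
  rw [norm_nhat, mul_one] at hc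
  rw [← hc] at h
  have hr2 : ‖r‖ ^ 2 ≤ 1 := by nlinarith [norm_nonneg r]
  have hs0 := Real.sin_nonneg_of_nonneg_of_le_pi (angle_nonneg r (nhat 0)) (angle_le_pi r (nhat 0))
  have hs1 := Real.sin_le (angle_nonneg r (nhat 0))
  have hs := Real.sin_sq_add_cos_sq (angle r (nhat 0))
  have hsr : Real.sin (angle r (nhat 0)) ^ 2 * ‖r‖ ^ 2 ≤ Real.sin (angle r (nhat 0)) ^ 2 :=
    mul_le_of_le_one_right (sq_nonneg _) hr2
  have hsa := pow_le_pow_left₀ hs0 hs1 2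
  have e : ‖r‖ ^ 2 = Real.sin (angle r (nhat 0)) ^ 2 * ‖r‖ ^ 2 +
      (Real.cos (angle r (nhat 0)) * ‖r‖) ^ 2 := by
    linear_combination -‖r‖ ^ 2 * hs
  linarith

lemma pcoin_eq (r : EuclideanSpace ℝ (Fin 3)) (δ s : ℝ) :
    pcoin r δ s =
      1 / 2 - (⟪r, nhat 0⟫ + s * Real.tan δ * ⟪r, what⟫) / (2 * Real.sqrt 2) := by
  rw [pcoin, inner_add_right, real_inner_smul_right]
  ring

lemma pcoin_mem_Icc {r : EuclideanSpace ℝ (Fin 3)} (hr : ‖r‖ ≤ 1) {δ : ℝ} (hδ0 : 0 < δ)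
    (hδ : δ ≤ 0.7) {s : ℝ} (hs : s = 1 ∨ s = -1) :
    0.01 ≤ pcoin r δ s ∧ pcoin r δ s ≤ 0.99 := by
  have h := inner_nhat_zero_sq_add_inner_what_sq_le r
  have hr2 : ‖r‖ ^ 2 ≤ 1 := by nlinarith [norm_nonneg r]
  have ht0 : 0 ≤ Real.tan δ :=
    Real.tan_nonneg_of_nonneg_of_le_pi_div_two hδ0.le (by linarith [Real.pi_gt_three])
  have ht1 : Real.tan δ ≤ 0.959 := by linarith [tan_le_mul_of_le hδ0 hδ]
  have ht2 : Real.tan δ ^ 2 ≤ 0.92 := by nlinarith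
  have hs2 : s ^ 2 = 1 := by rcases hs with rfl | rfl <;> norm_num
  rw [pcoin_eq]
  set a := ⟪r, nhat 0⟫
  set b := ⟪r, what⟫
  set t := Real.tan δ
  have hw : (0 : ℝ) < Real.sqrt 2 := by positivity
  have h2 : Real.sqrt 2 ^ 2 = 2 := Real.sq_sqrt (by norm_num)
  have hcs : (a + s * t * b) ^ 2 ≤ (0.98 * Real.sqrt 2) ^ 2 := by
    have e : (a + s * t * b) ^ 2 + (s * t * a - b) ^ 2 = (1 + t ^ 2) * (a ^ 2 + b ^ 2) := by
      linear_combination (t ^ 2 * (a ^ 2 + b ^ 2)) * hs2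
    have : (1 + t ^ 2) * (a ^ 2 + b ^ 2) ≤ 1.92 * 1 := by
      apply mul_le_mul <;> first | positivity | linarith
    nlinarith [sq_nonneg (s * t * a - b)]
  have habs := abs_le.mp (abs_le_of_sq_le_sq hcs (by positivity))
  have hle : (a + s * t * b) / (2 * Real.sqrt 2) ≤ 0.49 := by
    rw [div_le_iff₀ (by positivity)]
    linarith [habs.2]
  have hge : -0.49 ≤ (a + s * t * b) / (2 * Real.sqrt 2) := by
    rw [le_div_iff₀ (by positivity)]
    linarith [habs.1]
  constructor <;> linarith

lemma klBits_le_of_mem_Icc {p q : ℝ} (hp : 0.01 ≤ p ∧ p ≤ 0.99) (hq : 0.01 ≤ q ∧ q ≤ 0.99) :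
    klBits p q ≤ 150 * (p - q) ^ 2 := by
  obtain ⟨hp0, hp1⟩ := hp
  obtain ⟨hq0, hq1⟩ := hq
  refine (klBits_le_chi_sq (by linarith) (by linarith) (by linarith) (by linarith)).trans ?_
  have hl := Real.log_two_gt_d9
  have hqq : 0.0099 ≤ q * (1 - q) := by nlinarith
  have hden : 1 / 150 ≤ q * (1 - q) * Real.log 2 := by nlinarith
  rw [div_le_iff₀ (by linarith)]
  nlinarith [mul_le_mul_of_nonneg_left hden (sq_nonneg (p - q))]

/-- For `‖r‖ ≤ 1`, `0 < δ ≤ 0.7`, `u ∈ {-1,1}` and `α := ∠(r, n̂^{uδ})`: the coin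
probabilities `p_s` lie in `[0.01, 0.99]`, and both KL divergences (in bits) between the
corresponding Bernoulli distributions are at most `150 δ² (α + δ)²`. -/
theorem coin_kl_bound (r : EuclideanSpace ℝ (Fin 3)) (hr : ‖r‖ ≤ 1)
    (δ : ℝ) (hδ0 : 0 < δ) (hδ : δ ≤ 0.7) (u : ℝ) (hu : u = 1 ∨ u = -1) :
    (∀ s : ℝ, s = 1 ∨ s = -1 → 0.01 ≤ pcoin r δ s ∧ pcoin r δ s ≤ 0.99) ∧
    klBits (pcoin r δ 1) (pcoin r δ (-1)) ≤
      150 * δ ^ 2 * (angle r (nhat (u * δ)) + δ) ^ 2 ∧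
    klBits (pcoin r δ (-1)) (pcoin r δ 1) ≤
      150 * δ ^ 2 * (angle r (nhat (u * δ)) + δ) ^ 2 := by
  have hmem := fun s hs => pcoin_mem_Icc hr hδ0 hδ (s := s) hs
  have hp := hmem 1 (Or.inl rfl)
  have hm := hmem (-1) (Or.inr rfl)
  have hang : angle r (nhat 0) ≤ angle r (nhat (u * δ)) + δ := by
    have h := angle_le_angle_add_angle r (nhat (u * δ)) (nhat 0)
    rwa [angle_nhat_nhat_zero hδ0.le (by linarith [Real.pi_gt_three]) hu] at h
  have hb := (inner_what_sq_le hr).trans (pow_le_pow_left₀ (angle_nonneg r (nhat 0)) hang 2)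
  have ht0 : 0 ≤ Real.tan δ :=
    Real.tan_nonneg_of_nonneg_of_le_pi_div_two hδ0.le (by linarith [Real.pi_gt_three])
  have ht2 : Real.tan δ ^ 2 ≤ 2 * δ ^ 2 := by nlinarith [tan_le_mul_of_le hδ0 hδ]
  have hdiff : (pcoin r δ 1 - pcoin r δ (-1)) ^ 2 = Real.tan δ ^ 2 / 2 * ⟪r, what⟫ ^ 2 := by
    have h2 : Real.sqrt 2 ^ 2 = 2 := Real.sq_sqrt (by norm_num)
    have e : pcoin r δ 1 - pcoin r δ (-1) = -(Real.tan δ * ⟪r, what⟫) / Real.sqrt 2 := by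
      rw [pcoin_eq, pcoin_eq]
      field_simp
      ring
    rw [e, div_pow, h2]
    ring
  have hsq : (pcoin r δ 1 - pcoin r δ (-1)) ^ 2 ≤
      δ ^ 2 * (angle r (nhat (u * δ)) + δ) ^ 2 := by
    rw [hdiff]
    apply mul_le_mul _ hb (sq_nonneg _) (sq_nonneg _)
    linarith
  refine ⟨hmem, ?_, ?_⟩
  · linarith [klBits_le_of_mem_Icc hp hm]
  · have h := klBits_le_of_mem_Icc hm hp
    rw [← neg_sub, neg_sq] at h
    linarith
end
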